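/- Let t > 0 be a real number and let G be a t-tough graph on n ≥ 3 vertices. If the minimum degree of G satisfies δ(G) > n/(t+1) − 1, then G is hamiltonian. -/

import Mathlib

open SimpleGraph

/-- The number of connected components of `G − S`, the subgraph of `G` induced on the
complement of the vertex set `S`. -/
noncomputable def numComp {V : Type*} (G : SimpleGraph V) (S : Set V) : ℕ :=
  Nat.card (G.induce Sᶜ).ConnectedComponent

/-- A graph `G` is `t`-tough if `|S| ≥ t · c(G − S)` for every vertex set `S` whose removal
leaves at least two components. -/
def Tough {V : Type*} [Fintype V] (t : ℝ) (G : SimpleGraph V) : Prop :=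
  ∀ S : Finset V, 2 ≤ numComp G (S : Set V) →
    t * (numComp G (S : Set V) : ℝ) ≤ (S.card : ℝ)

/-- A list of vertices traversing a cycle of `G`, each vertex of the cycle being listed once. -/
structure IsCycleList {V : Type*} (G : SimpleGraph V) (L : List V) : Prop where
  nodup : L.Nodup
  three_le : 3 ≤ L.length
  chain : L.IsChain G.Adj
  closed : ∀ a ∈ L.getLast?, ∀ b ∈ L.head?, G.Adj a b

theorem IsCycleList.rotate {V : Type*} {G : SimpleGraph V} {A B : List V}
    (h : IsCycleList G (A ++ B)) : IsCycleList G (B ++ A) := by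
  obtain ⟨h1, h2, h3, h4⟩ := h
  rw [List.isChain_append] at h3
  obtain ⟨hA, hB, hAB⟩ := h3
  refine ⟨(List.perm_append_comm.nodup_iff).1 h1, by simp at h2 ⊢; omega, ?_, ?_⟩
  · rw [List.isChain_append]
    refine ⟨hB, hA, fun a ha b hb => h4 a ?_ b ?_⟩
    · rcases B with _ | ⟨c, B⟩ <;> simp_all
    · rcases A with _ | ⟨c, A⟩ <;> simp_all
  · intro a ha b hb
    rcases A with _ | ⟨c, A⟩
    · simp_all
    · rcases B with _ | ⟨d, B⟩
      · simp_all
      · rw [List.getLast?_append_of_ne_nil _ (by simp)] at ha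
        exact hAB a ha b (by simpa using hb)

theorem IsCycleList.isHamiltonian {V : Type*} [Fintype V] [DecidableEq V] {G : SimpleGraph V}
    {L : List V} (h : IsCycleList G L) (hL : ∀ v, v ∈ L) : G.IsHamiltonian := by
  intro _
  have hne : L ≠ [] := by
    rintro rfl
    simpa using h.three_le
  have hadj : G.Adj (L.getLast hne) (L.head hne) :=
    h.closed _ (List.getLast?_eq_some_getLast hne) _ (List.head?_eq_some_head hne)
  let p := Walk.ofSupport L hne h.chain
  refine ⟨_, Walk.cons hadj p, ?_⟩
  have hcard : Fintype.card V = L.length := by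
    rw [← List.toFinset_card_of_nodup h.nodup, ← Finset.card_univ]
    congr 1
    ext v
    simp [hL v]
  have hlen : p.length = L.length - 1 := Walk.length_ofSupport hne h.chain
  have h3 := h.three_le
  rw [Walk.isHamiltonianCycle_iff_isCycle_and_length_eq, Walk.isCycle_iff_isPath_tail_and_le_length]
  refine ⟨⟨?_, ?_⟩, ?_⟩
  · have : p.IsPath := by
      rw [Walk.isPath_def, Walk.support_ofSupport]
      exact h.nodup
    simpa using this
  · simp only [Walk.length_cons]; omega
  · simp only [Walk.length_cons]; omega

theorem isCycleList_of_isCycle {V : Type*} {G : SimpleGraph V} {u : V} {p : G.Walk u u}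
    (hp : p.IsCycle) : IsCycleList G p.support.tail := by
  have h3 := hp.three_le_length
  refine ⟨hp.support_nodup, by simpa using h3, p.isChain_adj_support.tail, ?_⟩
  intro a ha b hb
  cases p with
  | nil => simp at h3
  | cons hadj q =>
    rw [Walk.support_cons, List.tail_cons] at ha hb
    rw [List.getLast?_eq_some_getLast q.support_ne_nil, q.getLast_support] at ha
    rw [List.head?_eq_some_head q.support_ne_nil, q.head_support] at hb
    simp only [Option.mem_def, Option.some.injEq] at ha hb
    subst ha hb
    exact hadj

/-- The sets `A i` being nonempty, pairwise disjoint and pairwise without edges in between,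
their union induces at least as many components as there are sets. -/
theorem card_le_numComp {V ι : Type*} [Finite V] [Fintype ι] (G : SimpleGraph V) (A : ι → Set V)
    (hne : ∀ i, (A i).Nonempty)
    (hdisj : ∀ i j, i ≠ j → ∀ x ∈ A i, x ∉ A j)
    (hadj : ∀ i j, i ≠ j → ∀ x ∈ A i, ∀ y ∈ A j, ¬ G.Adj x y) :
    Fintype.card ι ≤ numComp G (⋃ i, A i)ᶜ := by
  choose a ha using hne
  have hmem : ∀ i, a i ∈ ((⋃ i, A i)ᶜ)ᶜ := fun i => by
    rw [compl_compl]
    exact Set.mem_iUnion.2 ⟨i, ha i⟩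
  have key : ∀ i (x y : ((⋃ i, A i)ᶜᶜ : Set V)),
      (G.induce ((⋃ i, A i)ᶜᶜ : Set V)).Walk x y → (x : V) ∈ A i → (y : V) ∈ A i := by
    intro i x y p
    induction p with
    | nil => exact id
    | @cons u v w huv p ih =>
      intro hu
      apply ih
      have hv : (v : V) ∈ ⋃ i, A i := by simpa only [compl_compl] using v.2
      obtain ⟨j, hj⟩ := Set.mem_iUnion.1 hv
      by_cases hij : i = j
      · exact hij ▸ hj
      · exact (hadj i j hij _ hu _ hj huv).elim
  rw [← Nat.card_eq_fintype_card]
  refine Nat.card_le_card_of_injective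
    (fun i => (G.induce ((⋃ i, A i)ᶜᶜ : Set V)).connectedComponentMk ⟨a i, hmem i⟩) ?_
  intro i j hij
  by_contra hne
  obtain ⟨p⟩ := ConnectedComponent.exact hij
  exact hdisj i j hne _ (key i _ _ p (ha i)) (ha j)

/-- The graph on `V` retaining the edges of `G` with both ends outside `C`. -/
def outside {V : Type*} (G : SimpleGraph V) (C : Set V) : SimpleGraph V where
  Adj u v := G.Adj u v ∧ u ∉ C ∧ v ∉ C
  symm := ⟨fun _ _ h => ⟨h.1.symm, h.2.2, h.2.1⟩⟩
  loopless := ⟨fun _ h => h.1.ne rfl⟩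

/-- The vertices of the component of `G − C` containing `v`, for `v ∉ C`. -/
def outComp {V : Type*} (G : SimpleGraph V) (C : Set V) (v : V) : Set V :=
  {w | (outside G C).Reachable v w}

/-- The set `A` together with all components of `G − C` having a neighbour in `A`. -/
def absorb {V : Type*} (G : SimpleGraph V) (C A : Set V) : Set V :=
  A ∪ {w | w ∉ C ∧ ∃ b, b ∉ C ∧ (outside G C).Reachable w b ∧ ∃ x ∈ A, G.Adj x b}

/-- Two vertices are linked if they are joined by an edge or by a path through a component
of `G − C`. -/
def Linked {V : Type*} (G : SimpleGraph V) (C : Set V) (x y : V) : Prop :=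
  G.Adj x y ∨ ∃ a b, a ∉ C ∧ b ∉ C ∧ (outside G C).Reachable a b ∧ G.Adj x a ∧ G.Adj y b

theorem Linked.symm {V : Type*} {G : SimpleGraph V} {C : Set V} {x y : V}
    (h : Linked G C x y) : Linked G C y x := by
  rcases h with h | ⟨a, b, ha, hb, hab, hxa, hyb⟩
  · exact Or.inl h.symm
  · exact Or.inr ⟨b, a, hb, ha, hab.symm, hyb, hxa⟩

theorem not_mem_of_reachable {V : Type*} {G : SimpleGraph V} {C : Set V} {u v : V} (hu : u ∉ C)
    (h : (outside G C).Reachable u v) : v ∉ C := by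
  obtain ⟨p⟩ := h
  induction p with
  | nil => exact hu
  | cons huv p ih => exact ih huv.2.2

/-- Vertices of two sets without links have disjoint, mutually nonadjacent absorptions. -/
theorem absorb_separated {V : Type*} {G : SimpleGraph V} {C A B : Set V} (hA : A ⊆ C) (hB : B ⊆ C)
    (hAB : ∀ x ∈ A, x ∉ B) (hlink : ∀ x ∈ A, ∀ y ∈ B, ¬ Linked G C x y) {x y : V}
    (hx : x ∈ absorb G C A) (hy : y ∈ absorb G C B) : x ≠ y ∧ ¬ G.Adj x y := by
  rcases hx with hx | ⟨hxC, b, hb, hxb, z, hz, hzb⟩ <;>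
  rcases hy with hy | ⟨hyC, b', hb', hyb, z', hz', hzb'⟩
  · refine ⟨?_, fun h => hlink x hx y hy (Or.inl h)⟩
    rintro rfl
    exact hAB _ hx hy
  · refine ⟨?_, fun h => hlink x hx z' hz' (Or.inr ⟨y, b', hyC, hb', hyb, h, hzb'⟩)⟩
    rintro rfl
    exact hyC (hA hx)
  · refine ⟨?_, fun h => hlink z hz y hy (Or.inr ⟨b, x, hb, hxC, hxb.symm, hzb, h.symm⟩)⟩
    rintro rfl
    exact hxC (hB hy)
  · refine ⟨?_, fun h => hlink z hz z' hz' (Or.inr ⟨b, b', hb, hb', ?_, hzb, hzb'⟩)⟩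
    · rintro rfl
      exact hlink z hz z' hz' (Or.inr ⟨b, b', hb, hb', hxb.symm.trans hyb, hzb, hzb'⟩)
    · exact (hxb.symm.trans (Adj.reachable (G := outside G C) ⟨h, hxC, hyC⟩)).trans hyb

theorem reachable_mem_absorb {V : Type*} {G : SimpleGraph V} {C C' A B : Set V}
    (hcover : ∀ x ∈ C, x ∉ C' → x ∈ A ∨ x ∈ B)
    (hlink : ∀ x ∈ A, ∀ y ∈ B, ¬ Linked G C x y) {x y : V}
    (hxy : (outside G C').Reachable x y) (hx : x ∈ absorb G C A) : y ∈ absorb G C A := by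
  obtain ⟨p⟩ := hxy
  induction p with
  | nil => exact hx
  | @cons u v w huv p ih =>
    apply ih
    obtain ⟨hadj, -, hv⟩ := huv
    by_cases hvC : v ∈ C
    · rcases hcover v hvC hv with hvA | hvB
      · exact Or.inl hvA
      · exfalso
        rcases hx with hu | ⟨hu, b, hb, hub, z, hz, hzb⟩
        · exact hlink u hu v hvB (Or.inl hadj)
        · exact hlink z hz v hvB (Or.inr ⟨b, u, hb, hu, hub.symm, hzb, hadj.symm⟩)
    · rcases hx with hu | ⟨hu, b, hb, hub, z, hz, hzb⟩
      · exact Or.inr ⟨hvC, v, hvC, Reachable.refl _, u, hu, hadj⟩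
      · exact Or.inr ⟨hvC, b, hb, (Adj.reachable (G := outside G C)
          ⟨hadj.symm, hvC, hu⟩).trans hub, z, hz, hzb⟩

/-- The vertices lying in a component of `G − C` of order `k`. -/
def levelSet {V : Type*} (G : SimpleGraph V) (C : Set V) (k : ℕ) : Set V :=
  {v | v ∉ C ∧ (outComp G C v).ncard = k}

/-- The components of `G − C` have order at most `k`, and no cycle with this property has fewer
vertices in components of order `k`. -/
structure IsOptimal {V : Type*} (G : SimpleGraph V) (C : Set V) (k : ℕ) : Prop where
  le : ∀ v ∉ C, (outComp G C v).ncard ≤ k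
  min : ∀ L, IsCycleList G L → (∀ v ∉ L, (outComp G {x | x ∈ L} v).ncard ≤ k) →
    (levelSet G C k).ncard ≤ (levelSet G {x | x ∈ L} k).ncard

theorem IsOptimal.not_exchange {V : Type*} [Finite V] {G : SimpleGraph V} {C : Set V} {k : ℕ}
    (hC : IsOptimal G C k) {L : List V} (hL : IsCycleList G L) {A B : Set V}
    (hcover : ∀ x ∈ C, x ∉ L → x ∈ A ∨ x ∈ B)
    (hlink : ∀ x ∈ A, ∀ y ∈ B, ¬ Linked G C x y)
    (hAk : (absorb G C A).ncard < k) (hBk : (absorb G C B).ncard < k)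
    {h : V} (hh : h ∈ levelSet G C k) : h ∉ L := by
  intro hhL
  have key : ∀ z ∉ L, k ≤ (outComp G {x | x ∈ L} z).ncard →
      z ∈ levelSet G C k ∧ (outComp G {x | x ∈ L} z).ncard = k := by
    intro z hz hk
    have hdis : ∀ y ∈ outComp G {x | x ∈ L} z, y ∉ C := by
      intro y hy hyC
      have hyL : y ∉ L := not_mem_of_reachable (C := {x | x ∈ L}) hz hy
      have aux : ∀ A B : Set V, (∀ x ∈ C, x ∉ L → x ∈ A ∨ x ∈ B) →
          (∀ x ∈ A, ∀ y ∈ B, ¬ Linked G C x y) → (absorb G C A).ncard < k → y ∉ A := by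
        intro A B hcover hlink hAk hyA
        have : outComp G {x | x ∈ L} z ⊆ absorb G C A := fun w hw =>
          reachable_mem_absorb (C' := {x | x ∈ L}) hcover hlink
            (Reachable.trans (Reachable.symm hy) hw) (Or.inl hyA)
        have := Set.ncard_le_ncard this (Set.toFinite _)
        omega
      rcases hcover y hyC hyL with h | h
      · exact aux A B hcover hlink hAk h
      · exact aux B A (fun x h1 h2 => (hcover x h1 h2).symm)
          (fun x hx y hy hl => hlink y hy x hx hl.symm) hBk h
    have hzC : z ∉ C := hdis z (Reachable.refl _)
    have hsub : outComp G {x | x ∈ L} z ⊆ outComp G C z := by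
      rintro w ⟨p⟩
      have : ∀ u, (outside G {x | x ∈ L}).Reachable z u →
          (outside G {x | x ∈ L}).Walk u w → (outside G C).Reachable u w := by
        intro u hu q
        induction q with
        | nil => exact Reachable.refl _
        | @cons a b c hab q ih =>
          have hb := hu.trans (Adj.reachable hab)
          exact (Adj.reachable (G := outside G C)
            ⟨hab.1, hdis _ hu, hdis _ hb⟩).trans (ih p hb)
      exact this z (Reachable.refl _) p
    have h1 := Set.ncard_le_ncard hsub (Set.toFinite _)
    have h2 := hC.le z hzC
    exact ⟨⟨hzC, by omega⟩, by omega⟩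
  have hle := hC.min L hL (fun v hv => by
    by_contra hlt
    have := (key v hv (by omega)).2
    omega)
  have hlt : (levelSet G {x | x ∈ L} k).ncard < (levelSet G C k).ncard := by
    refine Set.ncard_lt_ncard ?_ (Set.toFinite _)
    refine ⟨fun z hz => (key z hz.1 hz.2.ge).1, fun hsub => ?_⟩
    exact (hsub hh).1 hhL
  omega

theorem exists_path_list {V : Type*} {G : SimpleGraph V} {C : Set V} {a b : V} (ha : a ∉ C)
    (hab : (outside G C).Reachable a b) :
    ∃ P : List V, P.Nodup ∧ P.IsChain G.Adj ∧ P.head? = some a ∧ P.getLast? = some b ∧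
      ∀ z ∈ P, z ∉ C ∧ (outside G C).Reachable a z := by
  classical
  obtain ⟨p, hp⟩ := hab.exists_isPath
  refine ⟨p.support, hp.support_nodup, p.isChain_adj_support.imp fun _ _ h => h.1, ?_, ?_, ?_⟩
  · rw [List.head?_eq_some_head p.support_ne_nil, p.head_support]
  · rw [List.getLast?_eq_some_getLast p.support_ne_nil, p.getLast_support]
  · intro z hz
    have : (outside G C).Reachable a z := ⟨p.takeUntil z hz⟩
    exact ⟨not_mem_of_reachable ha this, this⟩

theorem Linked.exists_list {V : Type*} {G : SimpleGraph V} {C : Set V} {x y : V}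
    (h : Linked G C x y) :
    ∃ R : List V, R.Nodup ∧ R.IsChain G.Adj ∧ (∀ r ∈ R.head?, G.Adj x r) ∧
      (∀ r ∈ R.getLast?, G.Adj r y) ∧ (R = [] → G.Adj x y) ∧
      ∀ z ∈ R, z ∉ C ∧ ∃ a, G.Adj x a ∧ a ∉ C ∧ (outside G C).Reachable a z := by
  rcases h with h | ⟨a, b, ha, hb, hab, hxa, hyb⟩
  · exact ⟨[], by simp [h]⟩
  · obtain ⟨R, h1, h2, h3, h4, h5⟩ := exists_path_list ha hab
    refine ⟨R, h1, h2, ?_, ?_, ?_, fun z hz => ⟨(h5 z hz).1, a, hxa, ha, (h5 z hz).2⟩⟩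
    · rw [h3]; rintro r ⟨⟩; exact hxa
    · rw [h4]; rintro r ⟨⟩; exact hyb.symm
    · rintro rfl; simp at h3

/-- The neighbours in `C` of the component of `G − C` containing `h`. -/
def attach {V : Type*} (G : SimpleGraph V) (C : Set V) (h : V) : Set V :=
  {v | v ∈ C ∧ ∃ u ∈ outComp G C h, G.Adj v u}

theorem exists_attach_list {V : Type*} {G : SimpleGraph V} {C : Set V} {h v w : V} (hh : h ∉ C)
    (hv : v ∈ attach G C h) (hw : w ∈ attach G C h) :
    ∃ P : List V, P ≠ [] ∧ P.Nodup ∧ P.IsChain G.Adj ∧ (∀ r ∈ P.head?, G.Adj v r) ∧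
      (∀ r ∈ P.getLast?, G.Adj r w) ∧ ∀ z ∈ P, z ∉ C ∧ z ∈ outComp G C h := by
  obtain ⟨hvC, a, ha, hva⟩ := hv
  obtain ⟨hwC, b, hb, hwb⟩ := hw
  obtain ⟨P, h1, h2, h3, h4, h5⟩ := exists_path_list (not_mem_of_reachable hh ha)
    ((Reachable.symm ha).trans hb)
  refine ⟨P, ?_, h1, h2, ?_, ?_, fun z hz => ⟨(h5 z hz).1, Reachable.trans ha (h5 z hz).2⟩⟩
  · rintro rfl; simp at h3
  · rw [h3]; rintro r ⟨⟩; exact hva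
  · rw [h4]; rintro r ⟨⟩; exact hwb.symm

theorem mem_levelSet_of_mem_outComp {V : Type*} {G : SimpleGraph V} {C : Set V} {k : ℕ} {h u : V}
    (hh : h ∈ levelSet G C k) (hu : u ∈ outComp G C h) : u ∈ levelSet G C k := by
  refine ⟨not_mem_of_reachable hh.1 hu, ?_⟩
  rw [← hh.2]
  congr 1
  ext w
  exact ⟨fun hw => Reachable.trans hu hw, fun hw => Reachable.trans (Reachable.symm hu) hw⟩

theorem levelSet_pos {V : Type*} [Finite V] {G : SimpleGraph V} {C : Set V} {k : ℕ} {h : V}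
    (hh : h ∈ levelSet G C k) : 0 < k := by
  rw [← hh.2, Set.ncard_pos (Set.toFinite _)]
  exact ⟨h, Reachable.refl _⟩

/-- Bypassing a segment `A` of an optimal cycle through a component of maximum order. -/
theorem IsOptimal.le_absorb_gap {V : Type*} [Finite V] {G : SimpleGraph V} {C : Set V} {k : ℕ}
    (hC : IsOptimal G C k) {A N : List V} (hL : IsCycleList G (A ++ N))
    (hmem : ∀ x, x ∈ A ++ N ↔ x ∈ C) {h v w : V} (hh : h ∈ levelSet G C k)
    (hw : w ∈ attach G C h) (hv : v ∈ attach G C h) (hvw : v ≠ w)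
    (hNw : N.head? = some w) (hNv : N.getLast? = some v) :
    k ≤ (absorb G C {x | x ∈ A}).ncard := by
  by_contra! hlt
  obtain ⟨P, hPne, hPnd, hPc, hPh, hPl, hPmem⟩ := exists_attach_list hh.1 hv hw
  obtain ⟨u, hu⟩ := List.exists_mem_of_ne_nil P hPne
  have hLnd := List.nodup_append.1 hL.nodup
  have hLc := List.isChain_append.1 hL.chain
  have hcyc : IsCycleList G (N ++ P) := by
    refine ⟨?_, ?_, ?_, ?_⟩
    · refine List.nodup_append.2 ⟨hLnd.2.1, hPnd, ?_⟩
      rintro a ha b hb rfl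
      exact (hPmem a hb).1 ((hmem a).1 (by simp [ha]))
    · rcases N with _ | ⟨n1, _ | ⟨n2, N⟩⟩
      · simp at hNw
      · simp_all
      · have := List.length_pos_iff.2 hPne
        simp only [List.length_append, List.length_cons]
        omega
    · refine List.isChain_append.2 ⟨hLc.2.1, hPc, ?_⟩
      rw [hNv]
      rintro a ⟨⟩
      exact hPh
    · rw [List.getLast?_append_of_ne_nil _ hPne, List.head?_append, hNw]
      rintro a ha b ⟨⟩
      exact hPl a ha
  refine hC.not_exchange hcyc (A := {x | x ∈ A}) (B := ∅) ?_ ?_ hlt ?_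
    (mem_levelSet_of_mem_outComp hh (hPmem u hu).2) (by simp [hu])
  · intro x hx hx'
    have := (hmem x).2 hx
    simp_all
  · simp
  · simpa [absorb] using levelSet_pos hh

/-- Rerouting an optimal cycle through a component of maximum order and a link. -/
theorem IsOptimal.not_linked {V : Type*} [Finite V] {G : SimpleGraph V} {C : Set V} {k : ℕ}
    (hC : IsOptimal G C k) {A M B N : List V} (hL : IsCycleList G ((A ++ M) ++ (B ++ N)))
    (hmem : ∀ x, x ∈ (A ++ M) ++ (B ++ N) ↔ x ∈ C) {h v w x y : V} (hh : h ∈ levelSet G C k)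
    (hw : w ∈ attach G C h) (hv : v ∈ attach G C h) (hy : y ∉ attach G C h)
    (hMx : M.head? = some x) (hMw : M.getLast? = some w)
    (hNy : N.head? = some y) (hNv : N.getLast? = some v)
    (hlink : ∀ a ∈ A, ∀ b ∈ B, ¬ Linked G C a b)
    (hAk : (absorb G C {x | x ∈ A}).ncard < k) (hBk : (absorb G C {x | x ∈ B}).ncard < k) :
    ¬ Linked G C x y := by
  intro hxy
  obtain ⟨P, hPne, hPnd, hPc, hPh, hPl, hPmem⟩ := exists_attach_list hh.1 hw hv
  obtain ⟨R, hRnd, hRc, hRh, hRl, hRe, hRmem⟩ := hxy.symm.exists_list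
  obtain ⟨u, hu⟩ := List.exists_mem_of_ne_nil P hPne
  have hMne : M ≠ [] := by rintro rfl; simp at hMx
  have hNne : N ≠ [] := by rintro rfl; simp at hNy
  have hyC : y ∈ C := (hmem y).1 (by simp [List.mem_of_mem_head? hNy])
  have hPR : ∀ z ∈ P, z ∉ R := by
    intro z hzP hzR
    obtain ⟨-, a, hya, -, haz⟩ := hRmem z hzR
    exact hy ⟨hyC, a, Reachable.trans (hPmem z hzP).2 (Reachable.symm haz), hya⟩
  have hMC : ∀ z ∈ M, z ∈ C := fun z hz => (hmem z).1 (by simp [hz])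
  have hNC : ∀ z ∈ N, z ∈ C := fun z hz => (hmem z).1 (by simp [hz])
  have hLnd := List.nodup_append.1 hL.nodup
  have hLnd₁ := List.nodup_append.1 hLnd.1
  have hLnd₂ := List.nodup_append.1 hLnd.2.1
  have hLc := List.isChain_append.1 hL.chain
  have hMc := hLc.1.right_of_append
  have hNc : N.reverse.IsChain G.Adj := by
    rw [List.isChain_reverse]
    exact hLc.2.1.right_of_append.imp fun _ _ h => h.symm
  have hcyc : IsCycleList G ((M ++ P) ++ (N.reverse ++ R)) := by
    refine ⟨?_, ?_, ?_, ?_⟩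
    · refine List.nodup_append.2 ⟨List.nodup_append.2 ⟨hLnd₁.2.1, hPnd, ?_⟩,
        List.nodup_append.2 ⟨List.nodup_reverse.2 hLnd₂.2.1, hRnd, ?_⟩, ?_⟩
      · rintro a ha b hb rfl
        exact (hPmem a hb).1 (hMC a ha)
      · rintro a ha b hb rfl
        exact (hRmem a hb).1 (hNC a (List.mem_reverse.1 ha))
      · rintro a ha b hb rfl
        rw [List.mem_append, List.mem_reverse] at hb
        rw [List.mem_append] at ha
        rcases ha with ha | ha <;> rcases hb with hb | hb
        · exact hLnd.2.2 a (by simp [ha]) a (by simp [hb]) rfl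
        · exact (hRmem a hb).1 (hMC a ha)
        · exact (hPmem a ha).1 (hNC a hb)
        · exact hPR a ha hb
    · have h1 := List.length_pos_iff.2 hPne
      have h2 := List.length_pos_iff.2 hMne
      have h3 := List.length_pos_iff.2 hNne
      simp only [List.length_append, List.length_reverse]
      omega
    · refine List.isChain_append.2 ⟨List.isChain_append.2 ⟨hMc, hPc, ?_⟩,
        List.isChain_append.2 ⟨hNc, hRc, ?_⟩, ?_⟩
      · rw [hMw]
        rintro a ⟨⟩
        exact hPh
      · rw [List.getLast?_reverse, hNy]
        rintro a ⟨⟩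
        exact hRh
      · rw [List.getLast?_append_of_ne_nil _ hPne, List.head?_append, List.head?_reverse, hNv]
        rintro a ha b ⟨⟩
        exact hPl a ha
    · rw [List.append_assoc, List.head?_append, hMx, ← List.append_assoc]
      rintro a ha b ⟨⟩
      by_cases hR : R = []
      · rw [hR, List.append_nil, List.getLast?_append_of_ne_nil _ (by simpa using hNne),
          List.getLast?_reverse, hNy] at ha
        obtain ⟨⟩ := ha
        exact hRe hR
      · rw [← List.append_assoc, List.getLast?_append_of_ne_nil _ hR] at ha
        exact hRl a ha
  refine hC.not_exchange hcyc (A := {x | x ∈ A}) (B := {x | x ∈ B}) ?_ hlink hAk hBk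
    (mem_levelSet_of_mem_outComp hh (hPmem u hu).2) (by simp [hu])
  intro z hz hz'
  have := (hmem z).2 hz
  simp only [List.mem_append, List.mem_reverse, not_or, Set.mem_ofPred_eq] at this hz' ⊢
  tauto

/-- The concatenation of blocks, each block consisting of a segment and a vertex after it. -/
def joinBlocks {V : Type*} (l : List (List V × V)) : List V :=
  l.flatMap fun b => b.1 ++ [b.2]

@[simp] theorem joinBlocks_nil {V : Type*} : joinBlocks ([] : List (List V × V)) = [] := rfl

@[simp] theorem joinBlocks_cons {V : Type*} (b : List V × V) (l : List (List V × V)) :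
    joinBlocks (b :: l) = b.1 ++ b.2 :: joinBlocks l := by
  simp [joinBlocks]

@[simp] theorem joinBlocks_append {V : Type*} (l₁ l₂ : List (List V × V)) :
    joinBlocks (l₁ ++ l₂) = joinBlocks l₁ ++ joinBlocks l₂ := by
  simp [joinBlocks]

theorem getLast?_joinBlocks {V : Type*} {T : Set V} {l : List (List V × V)}
    (hl : ∀ b ∈ l, b.2 ∈ T) (hne : l ≠ []) : ∃ w ∈ T, (joinBlocks l).getLast? = some w := by
  obtain ⟨l, b, rfl⟩ := (List.eq_nil_or_concat' _).resolve_left hne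
  exact ⟨b.2, hl b (by simp), by simp⟩

theorem exists_joinBlocks_eq {V : Type*} (T : Set V) (L : List V)
    (hL : ∀ x ∈ L.getLast?, x ∈ T) :
    ∃ l, joinBlocks l = L ∧ ∀ b ∈ l, b.2 ∈ T ∧ ∀ a ∈ b.1, a ∉ T := by
  induction L with
  | nil => exact ⟨[], by simp⟩
  | cons x L ih =>
    rcases L with _ | ⟨y, L⟩
    · exact ⟨[([], x)], by simpa using hL⟩
    · obtain ⟨l, hl, hlT⟩ := ih (by simpa using hL)
      by_cases hx : x ∈ T
      · exact ⟨([], x) :: l, by simpa [hl, hx] using hlT⟩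
      · rcases l with _ | ⟨b, l⟩
        · simp at hl
        · refine ⟨(x :: b.1, b.2) :: l, by simpa using hl, ?_⟩
          simp only [List.mem_cons, forall_eq_or_imp] at hlT ⊢
          exact ⟨⟨hlT.1.1, hx, hlT.1.2⟩, hlT.2⟩

/-- The number of vertices of `A` to take until their absorption has order at least `k`. -/
noncomputable def fillLength {V : Type*} (G : SimpleGraph V) (C : Set V) (k : ℕ) (A : List V) : ℕ :=
  sInf {m | k ≤ (absorb G C {x | x ∈ A.take m}).ncard}

theorem le_absorb_fillLength {V : Type*} {G : SimpleGraph V} {C : Set V} {k : ℕ} {A : List V}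
    (hA : k ≤ (absorb G C {x | x ∈ A}).ncard) :
    k ≤ (absorb G C {x | x ∈ A.take (fillLength G C k A)}).ncard :=
  Nat.sInf_mem (s := {m | k ≤ (absorb G C {x | x ∈ A.take m}).ncard})
    ⟨A.length, by simpa using hA⟩

theorem absorb_lt_of_lt_fillLength {V : Type*} {G : SimpleGraph V} {C : Set V} {k : ℕ}
    {A : List V} {m : ℕ} (hm : m < fillLength G C k A) :
    (absorb G C {x | x ∈ A.take m}).ncard < k := by
  simpa using Nat.notMem_of_lt_sInf hm

theorem List.exists_lt_drop_eq_cons {V : Type*} {A : List V} {m : ℕ} {x : V} (hx : x ∈ A.take m) :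
    ∃ i < m, A.drop i = x :: A.drop (i + 1) := by
  obtain ⟨i, hi, rfl⟩ := List.mem_iff_getElem.1 hx
  rw [List.length_take, lt_min_iff] at hi
  exact ⟨i, hi.1, by rw [List.getElem_take, List.drop_eq_getElem_cons hi.2]⟩

theorem IsOptimal.le_absorb_block {V : Type*} [Finite V] {G : SimpleGraph V} {C : Set V} {k : ℕ}
    (hC : IsOptimal G C k) {l : List (List V × V)} (hL : IsCycleList G (joinBlocks l))
    (hmem : ∀ x, x ∈ joinBlocks l ↔ x ∈ C) {h : V} (hh : h ∈ levelSet G C k)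
    (hl : ∀ b ∈ l, b.2 ∈ attach G C h) (hl2 : 2 ≤ l.length) {b : List V × V} (hb : b ∈ l) :
    k ≤ (absorb G C {x | x ∈ b.1}).ncard := by
  obtain ⟨X, Z, rfl⟩ := List.append_of_mem hb
  have hne : Z ++ X ≠ [] := by
    rintro h
    simp_all
  obtain ⟨v, hv, hlast⟩ := getLast?_joinBlocks (T := attach G C h) (l := Z ++ X)
    (fun c hc => hl c (by simp at hc ⊢; tauto)) hne
  have hL' : IsCycleList G (b.1 ++ b.2 :: joinBlocks (Z ++ X)) := by
    have := hL
    rw [joinBlocks_append] at this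
    simpa using this.rotate
  refine hC.le_absorb_gap hL' (fun x => ?_) hh (hl b hb) hv ?_ rfl ?_
  · rw [← hmem]
    simp
    tauto
  · rintro rfl
    have h1 := (List.nodup_append.1 hL'.nodup).2.1
    exact (List.nodup_cons.1 h1).1 (List.mem_of_mem_getLast? hlast)
  · rw [List.getLast?_cons, hlast]
    rfl

theorem IsOptimal.not_linked_block {V : Type*} [Finite V] {G : SimpleGraph V} {C : Set V} {k : ℕ}
    (hC : IsOptimal G C k) {X Y Z : List (List V × V)} {b c : List V × V}
    (hL : IsCycleList G (joinBlocks (X ++ b :: (Y ++ c :: Z))))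
    (hmem : ∀ x, x ∈ joinBlocks (X ++ b :: (Y ++ c :: Z)) ↔ x ∈ C) {h : V}
    (hh : h ∈ levelSet G C k)
    (hl : ∀ d ∈ X ++ b :: (Y ++ c :: Z), d.2 ∈ attach G C h ∧ ∀ a ∈ d.1, a ∉ attach G C h)
    {x y : V} (hx : x ∈ b.1.take (fillLength G C k b.1))
    (hy : y ∈ c.1.take (fillLength G C k c.1)) : ¬ Linked G C x y := by
  classical
  intro hxy
  have hex : ∃ i < fillLength G C k b.1, ∃ x y, b.1.drop i = x :: b.1.drop (i + 1) ∧
      y ∈ c.1.take (fillLength G C k c.1) ∧ Linked G C x y := by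
    obtain ⟨i, hi, hix⟩ := List.exists_lt_drop_eq_cons hx
    exact ⟨i, hi, x, y, hix, hy, hxy⟩
  clear hx hy hxy x y
  obtain ⟨hi, x, y, hix, hy, hxy⟩ := Nat.find_spec hex
  have hmin := fun j => Nat.find_min hex (m := j)
  generalize Nat.find hex = i at *
  obtain ⟨j, hj, hjy⟩ := List.exists_lt_drop_eq_cons hy
  have hM : joinBlocks ((b.1.drop i, b.2) :: Y) = b.1.drop i ++ b.2 :: joinBlocks Y := by simp
  have hN : joinBlocks ((c.1.drop j, c.2) :: (Z ++ X)) =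
      c.1.drop j ++ c.2 :: joinBlocks (Z ++ X) := by simp
  obtain ⟨w, hw, hMw⟩ := getLast?_joinBlocks (T := attach G C h) (l := (b.1.drop i, b.2) :: Y)
    (fun d hd => by
      rcases List.mem_cons.1 hd with rfl | hd
      · exact (hl b (by simp)).1
      · exact (hl d (by simp [hd])).1) (by simp)
  obtain ⟨v, hv, hNv⟩ := getLast?_joinBlocks (T := attach G C h)
    (l := (c.1.drop j, c.2) :: (Z ++ X))
    (fun d hd => by
      rcases List.mem_cons.1 hd with rfl | hd
      · exact (hl c (by simp)).1
      · exact (hl d (by simp at hd ⊢; tauto)).1) (by simp)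
  have heq : (b.1.take i ++ joinBlocks ((b.1.drop i, b.2) :: Y)) ++
      (c.1.take j ++ joinBlocks ((c.1.drop j, c.2) :: (Z ++ X))) =
      joinBlocks (b :: (Y ++ c :: Z)) ++ joinBlocks X := by
    rw [hM, hN, ← List.append_assoc (b.1.take i), List.take_append_drop,
      ← List.append_assoc (c.1.take j),
      List.take_append_drop]
    simp
  refine hC.not_linked (A := b.1.take i) (M := joinBlocks ((b.1.drop i, b.2) :: Y))
    (B := c.1.take j) (N := joinBlocks ((c.1.drop j, c.2) :: (Z ++ X))) ?_ ?_ hh hw hv ?_ ?_ hMw ?_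
    hNv ?_ (absorb_lt_of_lt_fillLength hi) (absorb_lt_of_lt_fillLength hj) hxy
  · rw [heq]
    rw [joinBlocks_append] at hL
    exact hL.rotate
  · intro x
    rw [heq, ← hmem, joinBlocks_append]
    simp only [List.mem_append]
    tauto
  · exact (hl c (by simp)).2 y (List.mem_of_mem_take hy)
  · rw [hM, hix]
    rfl
  · rw [hN, hjy]
    rfl
  · intro a ha a' ha' hlink
    obtain ⟨i', hi', hia⟩ := List.exists_lt_drop_eq_cons ha
    exact hmin i' hi' ⟨hi'.trans hi, a, a', hia, List.take_subset_take_left _ hj.le ha', hlink⟩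

/-- An optimal non-hamiltonian cycle yields many separated vertex sets of order at least `k`. -/
theorem IsOptimal.exists_separated {V : Type*} [Finite V] {G : SimpleGraph V} {L : List V} {k : ℕ}
    (hL : IsCycleList G L) (hC : IsOptimal G {x | x ∈ L} k) {h : V}
    (hh : h ∈ levelSet G {x | x ∈ L} k) (hd : 2 ≤ (attach G {x | x ∈ L} h).ncard) :
    ∃ m, (attach G {x | x ∈ L} h).ncard ≤ m ∧ ∃ Q : Option (Fin m) → Set V,
      (∀ i, k ≤ (Q i).ncard) ∧
      ∀ i j, i ≠ j → ∀ x ∈ Q i, ∀ y ∈ Q j, x ≠ y ∧ ¬ G.Adj x y := by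
  set C : Set V := {x | x ∈ L} with hCdef
  obtain ⟨v, hv⟩ : (attach G C h).Nonempty := by
    rw [← Set.ncard_pos (Set.toFinite _)]
    omega
  obtain ⟨X, Y, hXY⟩ := List.append_of_mem (show v ∈ L from hv.1)
  obtain ⟨l, hl, hlT⟩ := exists_joinBlocks_eq (attach G C h) (Y ++ (X ++ [v])) (by simpa using hv)
  have hLl : IsCycleList G (joinBlocks l) := by
    have : L = (X ++ [v]) ++ Y := by simp [hXY]
    rw [hl]
    exact (this ▸ hL).rotate
  have hmem : ∀ x, x ∈ joinBlocks l ↔ x ∈ C := by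
    intro x
    rw [hl, hCdef, hXY]
    simp
    tauto
  have hle : (attach G C h).ncard ≤ l.length := by
    classical
    have hsub : attach G C h ⊆ ((l.map Prod.snd).toFinset : Set V) := by
      intro x hx
      have := (hmem x).2 hx.1
      simp only [joinBlocks, List.mem_flatMap, List.mem_append, List.mem_singleton] at this
      obtain ⟨b, hb, hxb | rfl⟩ := this
      · exact ((hlT b hb).2 x hxb hx).elim
      · simpa using ⟨b.1, hb⟩
    have h1 := Set.ncard_le_ncard hsub (Set.toFinite _)
    rw [Set.ncard_coe_finset] at h1
    have h2 := (l.map Prod.snd).toFinset_card_le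
    rw [List.length_map] at h2
    omega
  let S : List V × V → Set V := fun b => {x | x ∈ b.1.take (fillLength G C k b.1)}
  have hSC : ∀ b ∈ l, S b ⊆ C := by
    intro b hb x hx
    rw [← hmem]
    simp only [joinBlocks, List.mem_flatMap, List.mem_append]
    exact ⟨b, hb, Or.inl (List.mem_of_mem_take hx)⟩
  have hST : ∀ b ∈ l, ∀ x ∈ S b, x ∉ attach G C h := fun b hb x hx =>
    (hlT b hb).2 x (List.mem_of_mem_take hx)
  have hpair : l.Pairwise fun b c =>
      ∀ x ∈ absorb G C (S b), ∀ y ∈ absorb G C (S c), x ≠ y ∧ ¬ G.Adj x y := by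
    rw [List.pairwise_iff_forall_sublist]
    intro b c hbc x hx y hy
    have hb : b ∈ l := hbc.subset (by simp)
    have hc : c ∈ l := hbc.subset (by simp)
    obtain ⟨r₁, r₂, rfl, hb₁, hc₂⟩ := List.cons_sublist_iff.1 hbc
    obtain ⟨X, Y₁, rfl⟩ := List.append_of_mem hb₁
    obtain ⟨Y₂, Z, rfl⟩ := List.append_of_mem (List.singleton_sublist.1 hc₂)
    have heq : X ++ b :: Y₁ ++ (Y₂ ++ c :: Z) = X ++ b :: ((Y₁ ++ Y₂) ++ c :: Z) := by simp
    rw [heq] at hLl hmem hlT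
    refine absorb_separated (hSC b hb) (hSC c hc) ?_ ?_ hx hy
    · intro z hzb hzc
      have := hLl.nodup
      simp only [joinBlocks_append, joinBlocks_cons] at this
      have h1 := (List.nodup_append.1 (List.nodup_append.1 this).2.1).2.2 z
        (List.mem_of_mem_take hzb) z
      simp [List.mem_of_mem_take hzc] at h1
    · exact fun x hx y hy => hC.not_linked_block hLl hmem hh hlT hx hy
  have hH : ∀ b ∈ l, ∀ x ∈ absorb G C (S b), ∀ y ∈ outComp G C h, x ≠ y ∧ ¬ G.Adj x y := by
    intro b hb x hx y hy
    have hyC := not_mem_of_reachable hh.1 hy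
    rcases hx with hx | ⟨hxC, a, ha, hxa, z, hz, hza⟩
    · refine ⟨?_, fun hxy => hST b hb x hx ⟨hSC b hb hx, y, hy, hxy⟩⟩
      rintro rfl
      exact hyC (hSC b hb hx)
    · have key : ¬ (outside G C).Reachable y x := fun hyx =>
        hST b hb z hz ⟨hSC b hb hz, a, (Reachable.trans hy hyx).trans hxa, hza⟩
      refine ⟨?_, fun hxy => key (Adj.reachable (G := outside G C) ⟨hxy.symm, hyC, hxC⟩)⟩
      rintro rfl
      exact key (Reachable.refl _)
  refine ⟨l.length, hle, fun i => i.elim (outComp G C h) fun i => absorb G C (S l[i]), ?_, ?_⟩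
  · rintro (_ | i)
    · exact hh.2.ge
    · exact le_absorb_fillLength (hC.le_absorb_block hLl hmem hh (fun b hb => (hlT b hb).1)
        (by omega) (List.getElem_mem _))
  · rw [List.pairwise_iff_getElem] at hpair
    rintro (_ | i) (_ | j) hij x hx y hy
    · exact (hij rfl).elim
    · obtain ⟨h1, h2⟩ := hH _ (List.getElem_mem j.2) y hy x hx
      exact ⟨h1.symm, fun h => h2 h.symm⟩
    · exact hH _ (List.getElem_mem i.2) x hx y hy
    · have hij' : (i : ℕ) ≠ j := fun h => hij (by rw [Fin.ext h])
      rcases hij'.lt_or_gt with h | h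
      · exact hpair i j i.2 j.2 h x hx y hy
      · obtain ⟨h1, h2⟩ := hpair j i j.2 i.2 h y hy x hx
        exact ⟨h1.symm, fun h => h2 h.symm⟩

theorem Tough.mul_card_le {V ι : Type*} [Fintype V] [Fintype ι] {t : ℝ} {G : SimpleGraph V}
    (ht : 0 ≤ t) (htough : Tough t G) {Q : ι → Set V} (hι : 2 ≤ Fintype.card ι)
    (hne : ∀ i, (Q i).Nonempty)
    (hQ : ∀ i j, i ≠ j → ∀ x ∈ Q i, ∀ y ∈ Q j, x ≠ y ∧ ¬ G.Adj x y) :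
    t * Fintype.card ι ≤ ((⋃ i, Q i)ᶜ.ncard : ℝ) := by
  classical
  have h1 : Fintype.card ι ≤ numComp G (⋃ i, Q i)ᶜ :=
    card_le_numComp G Q hne (fun i j hij x hx hx' => (hQ i j hij x hx x hx').1 rfl)
      (fun i j hij x hx y hy => (hQ i j hij x hx y hy).2)
  have h2 := htough (⋃ i, Q i)ᶜ.toFinset
  rw [Set.coe_toFinset, ← Set.ncard_eq_toFinset_card'] at h2
  refine le_trans ?_ (h2 (hι.trans h1))
  gcongr

theorem Tough.mul_le_card {V ι : Type*} [Fintype V] [Fintype ι] {t : ℝ} {G : SimpleGraph V}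
    (ht : 0 ≤ t) (htough : Tough t G) {Q : ι → Set V} {k : ℕ} (hι : 2 ≤ Fintype.card ι)
    (hk : 0 < k) (hcard : ∀ i, k ≤ (Q i).ncard)
    (hQ : ∀ i j, i ≠ j → ∀ x ∈ Q i, ∀ y ∈ Q j, x ≠ y ∧ ¬ G.Adj x y) :
    (t + k) * Fintype.card ι ≤ Fintype.card V := by
  classical
  have h1 := htough.mul_card_le ht hι (fun i => (Set.ncard_pos (Set.toFinite _)).1
    (hk.trans_le (hcard i))) hQ
  have h2 : k * Fintype.card ι ≤ (⋃ i, Q i).ncard := by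
    have h3 : (⋃ i, Q i).ncard = ∑ i, (Q i).ncard := by
      have : (⋃ i, Q i) = ((Finset.univ.biUnion fun i => (Q i).toFinset : Finset V) : Set V) := by
        ext x; simp
      rw [this, Set.ncard_coe_finset, Finset.card_biUnion]
      · simp [Set.ncard_eq_toFinset_card']
      · intro i _ j _ hij
        rw [Function.onFun, Finset.disjoint_left]
        intro x hx hx'
        rw [Set.mem_toFinset] at hx hx'
        exact (hQ i j hij x hx x hx').1 rfl
    rw [h3, mul_comm, ← smul_eq_mul, ← Finset.card_univ]
    exact Finset.card_nsmul_le_sum _ _ _ fun i _ => hcard i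
  have h3 := Set.ncard_add_ncard_compl (⋃ i, Q i)
  rw [Nat.card_eq_fintype_card] at h3
  have h4 : (k : ℝ) * Fintype.card ι ≤ (⋃ i, Q i).ncard := by exact_mod_cast h2
  rw [← h3]
  push_cast
  linarith

theorem Tough.two_mul_le_ncard {V : Type*} [Fintype V] {t : ℝ} {G : SimpleGraph V}
    (ht : 0 ≤ t) (htough : Tough t G) {S A B : Set V} (hcover : ∀ x, x ∈ S ∨ x ∈ A ∨ x ∈ B)
    (hA : A.Nonempty) (hB : B.Nonempty) (hAB : ∀ x ∈ A, ∀ y ∈ B, x ≠ y ∧ ¬ G.Adj x y) :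
    2 * t ≤ S.ncard := by
  have h := htough.mul_card_le ht (Q := fun b : Bool => cond b A B) (by simp)
    (by rintro (_ | _) <;> assumption) (by
      rintro (_ | _) (_ | _) hij x hx y hy
      · exact (hij rfl).elim
      · exact ⟨(hAB y hy x hx).1.symm, fun h => (hAB y hy x hx).2 h.symm⟩
      · exact hAB x hx y hy
      · exact (hij rfl).elim)
  have hsub : (⋃ b : Bool, cond b A B)ᶜ ⊆ S := by
    intro x hx
    simp only [Set.mem_compl_iff, Set.mem_iUnion, Bool.exists_bool, cond_true, cond_false,
      not_or] at hx
    exact (hcover x).resolve_right (by tauto)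
  have h2 : ((⋃ b : Bool, cond b A B)ᶜ.ncard : ℝ) ≤ S.ncard := by
    exact_mod_cast Set.ncard_le_ncard hsub (Set.toFinite _)
  rw [Fintype.card_bool] at h
  push_cast at h
  linarith

/-- A tough graph of large minimum degree is `2`-connected. -/
theorem Tough.two_le_ncard {V : Type*} [Fintype V] {t : ℝ} {G : SimpleGraph V} (ht : 0 < t)
    (hn : 3 ≤ Fintype.card V) (htough : Tough t G)
    (hdelta : ∀ v, (Fintype.card V : ℝ) / (t + 1) - 1 < ((G.neighborSet v).ncard : ℝ))
    {S A B : Set V} (hcover : ∀ x, x ∈ S ∨ x ∈ A ∨ x ∈ B) (hSA : ∀ x ∈ A, x ∉ S)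
    (hSB : ∀ x ∈ B, x ∉ S) (hA : A.Nonempty) (hB : B.Nonempty)
    (hAB : ∀ x ∈ A, ∀ y ∈ B, x ≠ y ∧ ¬ G.Adj x y) : 2 ≤ S.ncard := by
  by_contra! hS
  have hS' : (S.ncard : ℝ) ≤ 1 := by exact_mod_cast Nat.le_of_lt_succ hS
  have h2t := htough.two_mul_le_ncard ht.le hcover hA hB hAB
  have hdeg : ∀ A' B' : Set V, (∀ x, x ∈ S ∨ x ∈ A' ∨ x ∈ B') → A'.Nonempty →
      (∀ x ∈ A', ∀ y ∈ B', ¬ G.Adj x y) →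
      (Fintype.card V : ℝ) / (t + 1) < A'.ncard + S.ncard := by
    rintro A' B' hcov ⟨a, ha⟩ hno
    have hsub : G.neighborSet a ⊆ (A' \ {a}) ∪ S := by
      intro x hx
      rcases hcov x with h | h | h
      · exact Or.inr h
      · exact Or.inl ⟨h, (G.ne_of_adj hx).symm⟩
      · exact (hno a ha x h hx).elim
    have h1 := Set.ncard_le_ncard hsub (Set.toFinite _)
    have h2 := Set.ncard_union_le (A' \ {a}) S
    have h3 := Set.ncard_sdiff_singleton_add_one ha (Set.toFinite _)
    have h4 : ((G.neighborSet a).ncard : ℝ) + 1 ≤ A'.ncard + S.ncard := by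
      exact_mod_cast (by omega : (G.neighborSet a).ncard + 1 ≤ A'.ncard + S.ncard)
    linarith [hdelta a]
  have hA' := hdeg A B hcover hA fun x hx y hy => (hAB x hx y hy).2
  have hB' := hdeg B A (fun x => by have := hcover x; tauto) hB
    fun x hx y hy h => (hAB y hy x hx).2 h.symm
  have hsum : A.ncard + B.ncard + S.ncard ≤ Fintype.card V := by
    rw [← Set.ncard_union_eq (Set.disjoint_left.2 fun x hx hx' => (hAB x hx x hx').1 rfl)
      (Set.toFinite _) (Set.toFinite _), ← Set.ncard_union_eq (Set.disjoint_left.2 ?_)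
      (Set.toFinite _) (Set.toFinite _), ← Nat.card_eq_fintype_card]
    · exact Set.ncard_le_card _
    · rintro x (hx | hx)
      · exact hSA x hx
      · exact hSB x hx
  have hsum' : (A.ncard : ℝ) + B.ncard + S.ncard ≤ Fintype.card V := by exact_mod_cast hsum
  have hn' : (3 : ℝ) ≤ Fintype.card V := by exact_mod_cast hn
  have hq : (Fintype.card V : ℝ) / (t + 1) * (t + 1) = Fintype.card V :=
    div_mul_cancel₀ _ (by linarith)
  have hq0 : (0 : ℝ) ≤ (Fintype.card V : ℝ) / (t + 1) := by positivity
  nlinarith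

theorem Tough.exists_isCycleList {V : Type*} [Fintype V] {t : ℝ} {G : SimpleGraph V} (ht : 0 < t)
    (hn : 3 ≤ Fintype.card V) (htough : Tough t G)
    (hdelta : ∀ v, (Fintype.card V : ℝ) / (t + 1) - 1 < ((G.neighborSet v).ncard : ℝ)) :
    ∃ L, IsCycleList G L := by
  classical
  have : Nontrivial V := Fintype.one_lt_card_iff_nontrivial.1 (by omega)
  have hconn : G.Connected := by
    refine ⟨fun u v => ?_⟩
    by_contra huv
    have := htough.two_le_ncard ht hn hdelta (S := ∅) (A := {w | G.Reachable u w})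
      (B := {w | ¬ G.Reachable u w}) (fun x => Or.inr (em _)) (by simp) (by simp)
      ⟨u, Reachable.refl _⟩ ⟨v, huv⟩ ?_
    · simp at this
    · refine fun x hx y hy => ⟨?_, fun h => hy (Reachable.trans hx h.reachable)⟩
      rintro rfl
      exact hy hx
  by_contra! hno
  have hacyc : G.IsAcyclic := fun v p hp => hno _ (isCycleList_of_isCycle hp)
  obtain ⟨v, hv⟩ := IsTree.exists_vert_degree_one_of_nontrivial ⟨hconn, hacyc⟩
  have hcard : (G.neighborSet v).ncard = 1 := by
    rw [← hv, ← G.card_neighborSet_eq_degree, Set.ncard_eq_toFinset_card', Set.toFinset_card]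
  have := htough.two_le_ncard ht hn hdelta (S := G.neighborSet v) (A := {v})
    (B := (insert v (G.neighborSet v))ᶜ) (fun x => ?_) (by simp) (fun x hx => ?_) (by simp) ?_ ?_
  · omega
  · by_cases h1 : x ∈ G.neighborSet v
    · exact Or.inl h1
    · by_cases h2 : x = v
      · exact Or.inr (Or.inl h2)
      · exact Or.inr (Or.inr (by simp_all))
  · exact fun h => hx (Or.inr h)
  · rw [← Set.ncard_pos (Set.toFinite _)]
    have h1 := Set.ncard_add_ncard_compl (insert v (G.neighborSet v))
    have h2 := Set.ncard_insert_le v (G.neighborSet v)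
    rw [Nat.card_eq_fintype_card] at h1
    omega
  · rintro x rfl y hy
    exact ⟨fun h => hy (Or.inl h.symm), fun h => hy (Or.inr h)⟩

theorem exists_isOptimal {V : Type*} [Finite V] {G : SimpleGraph V} (hcyc : ∃ L, IsCycleList G L)
    (hspan : ∀ L, IsCycleList G L → ∃ v, v ∉ L) :
    ∃ L k h, IsCycleList G L ∧ IsOptimal G {x | x ∈ L} k ∧ h ∈ levelSet G {x | x ∈ L} k := by
  classical
  have hex : ∃ k, ∃ L, IsCycleList G L ∧ ∀ v ∉ L, (outComp G {x | x ∈ L} v).ncard ≤ k := by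
    obtain ⟨L, hL⟩ := hcyc
    exact ⟨Nat.card V, L, hL, fun v _ => Set.ncard_le_card _⟩
  have hmin := fun j => Nat.find_min hex (m := j)
  obtain ⟨L₀, hL₀, hle₀⟩ := Nat.find_spec hex
  generalize Nat.find hex = k at *
  have hex' : ∃ m, ∃ L, IsCycleList G L ∧ (∀ v ∉ L, (outComp G {x | x ∈ L} v).ncard ≤ k) ∧
      (levelSet G {x | x ∈ L} k).ncard = m := ⟨_, L₀, hL₀, hle₀, rfl⟩
  obtain ⟨L, hL, hle, hm⟩ := Nat.find_spec hex'
  have hopt : IsOptimal G {x | x ∈ L} k := ⟨hle, fun L' hL' hle' => by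
    rw [hm]
    exact Nat.find_min' hex' ⟨L', hL', hle', rfl⟩⟩
  by_contra! hno
  have hlt : ∀ v ∉ L, (outComp G {x | x ∈ L} v).ncard < k := fun v hv =>
    (hle v hv).lt_of_ne fun h => hno L k v hL hopt ⟨hv, h⟩
  obtain ⟨v, hv⟩ := hspan L hL
  have hk := hlt v hv
  exact hmin (k - 1) (by omega) ⟨L, hL, fun w hw => by have := hlt w hw; omega⟩

/-- **Bauer–Broersma–van den Heuvel–Veldman.** If `G` is a `t`-tough graph on `n ≥ 3`
vertices with minimum degree `δ(G) > n/(t+1) − 1`, then `G` is hamiltonian. -/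
theorem stmt12 {V : Type*} [Fintype V] [DecidableEq V] (t : ℝ) (ht : 0 < t)
    (G : SimpleGraph V) (hn : 3 ≤ Fintype.card V) (htough : Tough t G)
    (hdelta : ∀ v : V, (Fintype.card V : ℝ) / (t + 1) - 1 <
      ((Nat.card (G.neighborSet v) : ℕ) : ℝ)) :
    G.IsHamiltonian := by
  simp only [Nat.card_coe_set_eq] at hdelta
  by_contra hham
  obtain ⟨L, k, h, hL, hopt, hh⟩ := exists_isOptimal (htough.exists_isCycleList ht hn hdelta)
    fun L hL => by
      by_contra! hall
      exact hham (hL.isHamiltonian hall)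
  set C : Set V := {x | x ∈ L}
  set T := attach G C h
  set H := outComp G C h
  have hk : 0 < k := levelSet_pos hh
  have hHC : ∀ x ∈ H, x ∉ C := fun x hx => not_mem_of_reachable hh.1 hx
  have hnbr : ∀ x ∈ H, ∀ y, G.Adj x y → y ∈ T ∨ y ∈ H := by
    intro x hx y hxy
    by_cases hy : y ∈ C
    · exact Or.inl ⟨hy, x, hx, hxy.symm⟩
    · exact Or.inr (Reachable.trans hx (Adj.reachable (G := outside G C) ⟨hxy, hHC x hx, hy⟩))
  have hcover : ∀ x, x ∈ T ∨ x ∈ H ∨ x ∈ (T ∪ H)ᶜ := fun x => by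
    rw [Set.mem_compl_iff, Set.mem_union]
    tauto
  have hsep : ∀ x ∈ H, ∀ y ∈ (T ∪ H)ᶜ, x ≠ y ∧ ¬ G.Adj x y := by
    refine fun x hx y hy => ⟨?_, fun hxy => hy (hnbr x hx y hxy)⟩
    rintro rfl
    exact hy (Or.inr hx)
  have hhH : h ∈ H := Reachable.refl _
  have hd : 2 ≤ T.ncard := by
    by_contra! hlt
    refine hlt.not_ge (htough.two_le_ncard ht hn hdelta hcover (fun x hx hx' => hHC x hx hx'.1)
      (fun x hx hx' => hx (Or.inl hx')) ⟨h, hhH⟩ ?_ hsep)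
    have hCcard : 3 ≤ C.ncard := by
      have : C = (L.toFinset : Set V) := by ext; simp [C]
      rw [this, Set.ncard_coe_finset, List.toFinset_card_of_nodup hL.nodup]
      exact hL.three_le
    obtain ⟨x, hxC, hxT⟩ := Set.exists_mem_notMem_of_ncard_lt_ncard (s := T) (t := C) (by omega)
      (Set.toFinite _)
    exact ⟨x, fun hx => hx.elim hxT fun hx => hHC x hx hxC⟩
  obtain ⟨m, hm, Q, hQk, hQ⟩ := hopt.exists_separated hL hh hd
  change T.ncard ≤ m at hm
  have hbig := htough.mul_le_card (ι := Option (Fin m)) ht.le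
    (by rw [Fintype.card_option, Fintype.card_fin]; omega) hk hQk hQ
  rw [Fintype.card_option, Fintype.card_fin] at hbig
  have hdeg : (Fintype.card V : ℝ) / (t + 1) < T.ncard + k := by
    have hsub : G.neighborSet h ⊆ T ∪ (H \ {h}) := by
      intro x hx
      rcases hnbr h hhH x hx with h | h
      · exact Or.inl h
      · exact Or.inr ⟨h, (G.ne_of_adj hx).symm⟩
    have h1 := Set.ncard_le_ncard hsub (Set.toFinite _)
    have h2 := Set.ncard_union_le T (H \ {h})
    have h3 := Set.ncard_sdiff_singleton_add_one hhH (Set.toFinite _)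
    have h4 : H.ncard = k := hh.2
    have h5 : ((G.neighborSet h).ncard : ℝ) + 1 ≤ T.ncard + k := by
      exact_mod_cast (by omega : (G.neighborSet h).ncard + 1 ≤ T.ncard + k)
    linarith [hdelta h]
  rw [div_lt_iff₀ (by linarith)] at hdeg
  have hm' : (T.ncard : ℝ) ≤ m := by exact_mod_cast hm
  have hd' : (2 : ℝ) ≤ T.ncard := by exact_mod_cast hd
  have hk' : (1 : ℝ) ≤ k := by exact_mod_cast hk
  have hbig' : (t + k) * (T.ncard + 1) ≤ Fintype.card V := by
    refine le_trans ?_ hbig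
    push_cast
    gcongr
  rcases Set.eq_empty_or_nonempty (T ∪ H)ᶜ with hempty | hne
  · have hle : Fintype.card V ≤ T.ncard + k := by
      rw [← Nat.card_eq_fintype_card, ← Set.ncard_univ, ← Set.compl_empty_iff.1 hempty, ← hh.2]
      exact Set.ncard_union_le _ _
    have hle' : (Fintype.card V : ℝ) ≤ T.ncard + k := by exact_mod_cast hle
    nlinarith
  · have h2t := htough.two_mul_le_ncard ht.le hcover ⟨h, hhH⟩ hne hsep
    nlinarith [mul_nonneg (sub_nonneg.2 hk') (by linarith : (0 : ℝ) ≤ T.ncard - t)]
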